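/- Let A ∈ ℂ^{n×n}, σ ∈ ℂ, U, Ũ ∈ ℂ^{n×k}, W, W̃ ∈ ℂ^{n×m}, and r₀ ∈ ℂⁿ, and suppose Ũ*(A + σI)U ∈ ℂ^{k×k} is invertible; let Φ = (A + σI)U (Ũ*(A + σI)U)⁻¹ Ũ*. Then for z ∈ ℂ^k and y ∈ ℂ^m, the residual r = r₀ − (A + σI)(Uz + Wy) is orthogonal to every column of Ũ and to every column of W̃ if and only if y satisfies W̃*(I − Φ)(A + σI)W y = W̃*(I − Φ) r₀ and z = (Ũ*(A + σI)U)⁻¹ Ũ*(r₀ − (A + σI)W y). -/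

import Mathlib

open Matrix

/-- With `Φ = (A+σI)U (Ũ*(A+σI)U)⁻¹ Ũ*`, the residual
`r = r₀ − (A+σI)(Uz + Wy)` is orthogonal to every column of `Ũ` and every column of `W̃`
iff `y` solves `W̃*(I − Φ)(A+σI)W y = W̃*(I − Φ) r₀` and
`z = (Ũ*(A+σI)U)⁻¹ Ũ*(r₀ − (A+σI)W y)`. -/
theorem augmented_residual_constraint_iff {n k m : ℕ}
    (A : Matrix (Fin n) (Fin n) ℂ) (σ : ℂ)
    (U Ut : Matrix (Fin n) (Fin k) ℂ) (W Wt : Matrix (Fin n) (Fin m) ℂ)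
    (r₀ : Fin n → ℂ)
    (hinv : IsUnit (Utᴴ * (A + σ • (1 : Matrix (Fin n) (Fin n) ℂ)) * U))
    (z : Fin k → ℂ) (y : Fin m → ℂ) :
    ((∀ c : Fin k, ∑ p, star (Ut p c) *
        ((r₀ - (A + σ • (1 : Matrix (Fin n) (Fin n) ℂ)).mulVec
          (U.mulVec z + W.mulVec y)) p) = 0) ∧
     (∀ c : Fin m, ∑ p, star (Wt p c) *
        ((r₀ - (A + σ • (1 : Matrix (Fin n) (Fin n) ℂ)).mulVec
          (U.mulVec z + W.mulVec y)) p) = 0)) ↔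
    ((Wtᴴ * ((1 : Matrix (Fin n) (Fin n) ℂ) -
        (A + σ • 1) * U * (Utᴴ * (A + σ • 1) * U)⁻¹ * Utᴴ) *
        (A + σ • (1 : Matrix (Fin n) (Fin n) ℂ)) * W).mulVec y =
      (Wtᴴ * ((1 : Matrix (Fin n) (Fin n) ℂ) -
        (A + σ • 1) * U * (Utᴴ * (A + σ • 1) * U)⁻¹ * Utᴴ)).mulVec r₀ ∧
     z = ((Utᴴ * (A + σ • (1 : Matrix (Fin n) (Fin n) ℂ)) * U)⁻¹ * Utᴴ).mulVec
          (r₀ - (A + σ • (1 : Matrix (Fin n) (Fin n) ℂ)).mulVec (W.mulVec y))) := by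
  have hU : ∀ (l : ℕ) (V : Matrix (Fin n) (Fin l) ℂ) (v : Fin n → ℂ),
      (∀ c : Fin l, ∑ p, star (V p c) * v p = 0) ↔ Vᴴ *ᵥ v = 0 := by
    intro l V v
    rw [funext_iff]
    rfl
  rw [hU, hU]
  generalize A + σ • (1 : Matrix (Fin n) (Fin n) ℂ) = B at *
  generalize hM : Utᴴ * B * U = M at *
  have hdet : IsUnit M.det := (Matrix.isUnit_iff_isUnit_det M).mp hinv
  have hs : r₀ - B *ᵥ (U *ᵥ z + W *ᵥ y) = (r₀ - B *ᵥ (W *ᵥ y)) - B *ᵥ (U *ᵥ z) := by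
    rw [Matrix.mulVec_add]; abel
  have h2 : ((Wtᴴ * (1 - B * U * M⁻¹ * Utᴴ) * B * W) *ᵥ y =
      (Wtᴴ * (1 - B * U * M⁻¹ * Utᴴ)) *ᵥ r₀) ↔
      (Wtᴴ * (1 - B * U * M⁻¹ * Utᴴ)) *ᵥ (r₀ - B *ᵥ (W *ᵥ y)) = 0 := by
    rw [Matrix.mulVec_sub, sub_eq_zero, Matrix.mulVec_mulVec, Matrix.mulVec_mulVec]
    exact eq_comm
  rw [hs, h2]
  generalize r₀ - B *ᵥ (W *ᵥ y) = s
  have h1 : Utᴴ *ᵥ (s - B *ᵥ (U *ᵥ z)) = 0 ↔ z = (M⁻¹ * Utᴴ) *ᵥ s := by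
    have e : Utᴴ *ᵥ (B *ᵥ (U *ᵥ z)) = M *ᵥ z := by
      rw [← hM]; simp only [Matrix.mulVec_mulVec, Matrix.mul_assoc]
    rw [Matrix.mulVec_sub, sub_eq_zero, e, ← Matrix.mulVec_mulVec]
    constructor
    · intro h
      rw [h, Matrix.mulVec_mulVec, Matrix.nonsing_inv_mul _ hdet, Matrix.one_mulVec]
    · intro h
      rw [h, Matrix.mulVec_mulVec, Matrix.mul_nonsing_inv _ hdet, Matrix.one_mulVec]
  rw [h1, and_comm]
  refine and_congr_left fun h => ?_
  have e : Wtᴴ *ᵥ (s - B *ᵥ (U *ᵥ z)) = (Wtᴴ * (1 - B * U * M⁻¹ * Utᴴ)) *ᵥ s := by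
    rw [h, ← Matrix.mulVec_mulVec s Wtᴴ, Matrix.sub_mulVec, Matrix.one_mulVec]
    simp only [Matrix.mulVec_mulVec, Matrix.mul_assoc]
  rw [e]
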